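/- Let L be an integrable real random variable with E[L] = 0 and distribution function F, and write β* = P[L ≤ e_α(L)]. (i) If F belongs to the Gumbel maximum domain of attraction MDA(Λ), i.e. U(t) := q_L(1 − 1/t) satisfies (U(tx) − U(t))/a(t) → ln x for all x > 0 for some positive function a, then (1−α)/(1−β*) → 0 as α ↗ 1. (ii) If furthermore F(x) = 1 − exp(−x^τ·g(x)) for all sufficiently large x, where τ > 0 and g is slowly varying (g ∈ RV_0), then ln(e_α(L))/ln(ES_α(L)) → 1 as α ↗ 1. (iii) If in addition lim_{x→∞} (g(cx)/g(x) − 1)·ln g(x) = 0 for some constant c > 0, then e_α(L)/ES_α(L) → 1 as α ↗ 1. -/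

import Mathlib

open MeasureTheory Filter Topology Real Set
open scoped ENNReal

/-- Left-quantile function: `q_L(u) = inf {m : P[L ≤ m] ≥ u}`. -/
noncomputable def leftQuantile {Ω : Type*} [MeasurableSpace Ω] (P : Measure Ω)
    (L : Ω → ℝ) (u : ℝ) : ℝ :=
  sInf {m : ℝ | u ≤ (P {ω | L ω ≤ m}).toReal}

/-- Expected shortfall: `ES_α(L) = (1/(1-α)) ∫_α^1 q_L(u) du`. -/
noncomputable def ES {Ω : Type*} [MeasurableSpace Ω] (P : Measure Ω)
    (L : Ω → ℝ) (α : ℝ) : ℝ :=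
  (1 - α)⁻¹ * ∫ u in α..1, leftQuantile P L u

/-- The α-expectile is the (unique) `e` with `α E[(L-e)⁺] = (1-α) E[(L-e)⁻]`. -/
def IsExpectile {Ω : Type*} [MeasurableSpace Ω] (P : Measure Ω)
    (L : Ω → ℝ) (α e : ℝ) : Prop :=
  α * ∫ ω, max (L ω - e) 0 ∂P = (1 - α) * ∫ ω, max (e - L ω) 0 ∂P

/-- Loss function `ℓ_{a,b}(x) = x⁺/a - b x⁻`. -/
noncomputable def lossFn (a b x : ℝ) : ℝ := max x 0 / a - b * max (-x) 0

/-- Optimized certainty equivalent `R_{a,b}(L) = inf { m + E[ℓ_{a,b}(L-m)] }`. -/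
noncomputable def OCE {Ω : Type*} [MeasurableSpace Ω] (P : Measure Ω)
    (L : Ω → ℝ) (a b : ℝ) : ℝ :=
  sInf {r : ℝ | ∃ m : ℝ, r = m + ∫ ω, lossFn a b (L ω - m) ∂P}

/-- `g` is regularly varying at infinity with index `ρ`. -/
def RegularlyVarying (g : ℝ → ℝ) (ρ : ℝ) : Prop :=
  ∀ x : ℝ, 0 < x → Tendsto (fun t => g (t * x) / g t) atTop (𝓝 (x ^ ρ))

/-- `g` is of second-order regular variation with indices `-η`, `ρ` and auxiliary function `A`. -/
def SecondOrderRV (g : ℝ → ℝ) (η ρ : ℝ) (A : ℝ → ℝ) : Prop :=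
  RegularlyVarying g (-η) ∧
  Tendsto A atTop (𝓝 0) ∧
  ((∀ᶠ t in atTop, 0 < A t) ∨ (∀ᶠ t in atTop, A t < 0)) ∧
  ∀ x : ℝ, 0 < x →
    Tendsto (fun t => (g (t * x) / g t - x ^ (-η)) / A t) atTop
      (𝓝 (if ρ = 0 then x ^ (-η) * Real.log x else x ^ (-η) * (x ^ ρ - 1) / ρ))

/-- Empirical measure `(1/n) ∑_{k<n} δ_{L_k(ω)}` of the first `n` samples. -/
noncomputable def empMeasure {Ω : Type*} [MeasurableSpace Ω] (L : ℕ → Ω → ℝ)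
    (n : ℕ) (ω : Ω) : Measure ℝ :=
  (n : ℝ≥0∞)⁻¹ • ∑ k ∈ Finset.range n, Measure.dirac (L k ω)

open ProbabilityTheory in
/-- quantile of a law -/
noncomputable def qf (μ : Measure ℝ) (u : ℝ) : ℝ := sInf {m : ℝ | u ≤ cdf μ m}

open ProbabilityTheory in
lemma qf_le_iff (μ : Measure ℝ) {u : ℝ} (h0 : 0 < u) (h1 : u < 1) (x : ℝ) :
    qf μ u ≤ x ↔ u ≤ cdf μ x := by
  have hbdd : BddBelow {m : ℝ | u ≤ cdf μ m} := by
    obtain ⟨b, hb⟩ := ((tendsto_cdf_atBot μ).eventually (gt_mem_nhds h0)).exists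
    refine ⟨b, fun m hm => ?_⟩
    by_contra hlt
    have := monotone_cdf μ (not_le.1 hlt).le
    exact absurd (le_trans hm this) (not_le.2 hb)
  have hne : {m : ℝ | u ≤ cdf μ m}.Nonempty := by
    obtain ⟨b, hb⟩ := ((tendsto_cdf_atTop μ).eventually (lt_mem_nhds h1)).exists
    exact ⟨b, hb.le⟩
  constructor
  · intro h
    have key : ∀ y, qf μ u < y → u ≤ cdf μ y := by
      intro y hy
      obtain ⟨m, hm, hmy⟩ := exists_lt_of_csInf_lt hne hy
      exact le_trans hm (monotone_cdf μ hmy.le)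
    have hc : Tendsto (cdf μ) (𝓝[>] x) (𝓝 (cdf μ x)) :=
      ((cdf μ).right_continuous x).mono_left (nhdsWithin_mono _ Ioi_subset_Ici_self)
    refine ge_of_tendsto hc ?_
    filter_upwards [self_mem_nhdsWithin] with y hy
    exact key y (lt_of_le_of_lt h hy)
  · intro h
    exact csInf_le hbdd h

lemma lt_qf_iff (μ : Measure ℝ) {u : ℝ} (h0 : 0 < u) (h1 : u < 1) (x : ℝ) :
    x < qf μ u ↔ ProbabilityTheory.cdf μ x < u := by
  rw [← not_le, qf_le_iff μ h0 h1, not_le]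

lemma qf_mono (μ : Measure ℝ) : MonotoneOn (qf μ) (Ioo 0 1) := by
  intro u hu v hv huv
  rw [qf_le_iff μ hu.1 hu.2]
  exact huv.trans ((qf_le_iff μ hv.1 hv.2 _).1 le_rfl)

lemma qf_aemeas (μ : Measure ℝ) : AEMeasurable (qf μ) (volume.restrict (Ioo 0 1)) :=
  aemeasurable_restrict_of_monotoneOn measurableSet_Ioo (qf_mono μ)

open ProbabilityTheory in
lemma qf_map (μ : Measure ℝ) [IsProbabilityMeasure μ] :
    (volume.restrict (Ioo (0:ℝ) 1)).map (qf μ) = μ := by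
  symm
  apply Measure.ext_of_Iic
  intro x
  rw [Measure.map_apply_of_aemeasurable (qf_aemeas μ) measurableSet_Iic,
    Measure.restrict_apply' measurableSet_Ioo, ← ofReal_cdf μ x]
  have hs : qf μ ⁻¹' Iic x ∩ Ioo 0 1 = Iic (cdf μ x) ∩ Ioo 0 1 := by
    ext u
    simp only [mem_inter_iff, mem_preimage, mem_Iic]
    constructor
    · rintro ⟨h, hu⟩
      exact ⟨(qf_le_iff μ hu.1 hu.2 x).1 h, hu⟩
    · rintro ⟨h, hu⟩
      exact ⟨(qf_le_iff μ hu.1 hu.2 x).2 h, hu⟩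
  rw [hs]
  apply le_antisymm
  · calc ENNReal.ofReal (cdf μ x) = volume (Ioo 0 (cdf μ x)) := by simp
      _ ≤ _ := by
        apply measure_mono
        intro u hu
        exact ⟨hu.2.le, hu.1, lt_of_lt_of_le hu.2 (cdf_le_one μ x)⟩
  · calc _ ≤ volume (Icc 0 (cdf μ x)) := by
          apply measure_mono
          intro u hu
          exact ⟨hu.2.1.le, hu.1⟩
      _ = _ := by simp

lemma qf_integral (μ : Measure ℝ) [IsProbabilityMeasure μ] (f : ℝ → ℝ) (hf : Measurable f) :
    ∫ x, f x ∂μ = ∫ u in Ioo (0:ℝ) 1, f (qf μ u) := by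
  conv_lhs => rw [← qf_map μ]
  exact integral_map (qf_aemeas μ) hf.aestronglyMeasurable

lemma qf_integrable (μ : Measure ℝ) [IsProbabilityMeasure μ] (h : Integrable (fun x => x) μ) :
    IntegrableOn (qf μ) (Ioo (0:ℝ) 1) := by
  rw [← qf_map μ] at h
  exact (integrable_map_measure (g := fun x : ℝ => x) measurable_id.aestronglyMeasurable
    (qf_aemeas μ)).1 h

/-- Gumbel mean-excess in quantile form. -/
lemma gumbel_core (q a : ℝ → ℝ) (ha : ∀ t, 0 < a t) (hmono : MonotoneOn q (Ioo 0 1))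
    (hint : IntegrableOn q (Ioo 0 1))
    (hg : ∀ x : ℝ, 0 < x →
      Tendsto (fun t : ℝ => (q (1 - 1 / (t * x)) - q (1 - 1 / t)) / a t) atTop (𝓝 (Real.log x)))
    (hpos : ∃ u ∈ Ioo (0:ℝ) 1, 0 < q u) (ε : ℝ) (hε : 0 < ε) :
    ∀ᶠ β in 𝓝[<] (1:ℝ), 0 < q β ∧ ∫ u in β..1, (q u - q β) ≤ ε * ((1 - β) * q β) := by
  set V : ℝ → ℝ := fun t => q (1 - 1 / t) with hV
  have hmem : ∀ t : ℝ, 1 < t → 1 - 1 / t ∈ Ioo (0:ℝ) 1 := by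
    intro t ht
    have h1 : 1 / t < 1 := by rw [div_lt_one (by linarith)]; exact ht
    have h2 : 0 < 1 / t := by positivity
    constructor <;> linarith
  have hVmono : ∀ s t : ℝ, 1 < s → s ≤ t → V s ≤ V t := by
    intro s t hs hst
    apply hmono (hmem s hs) (hmem t (by linarith))
    have := one_div_le_one_div_of_le (by linarith : 0 < s) hst
    linarith
  -- doubling
  have hl2 : 0 < Real.log 2 := Real.log_pos (by norm_num)
  have hD2 := hg 2 (by norm_num)
  have hD4 := hg 4 (by norm_num)
  have hl4 : Real.log 4 = 2 * Real.log 2 := by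
    rw [show (4:ℝ) = 2 ^ 2 by norm_num, Real.log_pow]; norm_num
  have hsq : (1.4:ℝ) < √2 := by
    apply Real.lt_sqrt_of_sq_lt; norm_num
  have hdbl : ∀ᶠ t in atTop, V (t * 4) - V (t * 2) ≤ √2 * (V (t * 2) - V t) := by
    have h1 : Tendsto (fun t => (√2 * ((V (t * 2) - V t) / a t)) -
        ((V (t * 4) - V t) / a t - (V (t * 2) - V t) / a t)) atTop
        (𝓝 (√2 * Real.log 2 - (Real.log 4 - Real.log 2))) :=
      (hD2.const_mul _).sub (hD4.sub hD2)
    have h2 : 0 < √2 * Real.log 2 - (Real.log 4 - Real.log 2) := by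
      rw [hl4]; nlinarith
    filter_upwards [h1.eventually (lt_mem_nhds h2)] with t ht
    have hat := ha t
    have : √2 * ((V (t * 2) - V t) / a t) -
        ((V (t * 4) - V t) / a t - (V (t * 2) - V t) / a t) =
        (√2 * (V (t * 2) - V t) - (V (t * 4) - V (t * 2))) / a t := by
      field_simp; ring
    rw [this] at ht
    have := (div_pos_iff_of_pos_right hat).1 ht
    linarith
  obtain ⟨T, hT⟩ := eventually_atTop.1 hdbl
  have hpow : ∀ k : ℕ, ∀ t : ℝ, T ≤ t → 1 < t →
      V (t * 2 ^ k) - V t ≤ 3 * (√2 ^ k - 1) * (V (t * 2) - V t) := by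
    intro k
    induction k with
    | zero => intro t _ _; simp
    | succ k ih =>
      intro t ht ht1
      have h1 := ih (t * 2) (by linarith) (by linarith)
      have h2 := hT t ht
      have h3 : 0 ≤ V (t * 2) - V t := sub_nonneg.2 (hVmono _ _ ht1 (by linarith))
      have hk : 1 ≤ √2 ^ k := one_le_pow₀ (by linarith)
      rw [show t * 2 * 2 ^ k = t * 2 ^ (k + 1) by ring, show t * 2 * 2 = t * 4 by ring] at h1
      have h4 : 3 * (√2 ^ k - 1) * (V (t * 4) - V (t * 2)) ≤
          3 * (√2 ^ k - 1) * (√2 * (V (t * 2) - V t)) :=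
        mul_le_mul_of_nonneg_left h2 (by linarith)
      rw [pow_succ √2 k]
      have h6 : 0 ≤ (3 * √2 - 4) * (V (t * 2) - V t) := mul_nonneg (by linarith) h3
      nlinarith
  -- pointwise
  have hpt : ∀ t : ℝ, T ≤ t → 1 < t → ∀ s : ℝ, 1 ≤ s →
      V (t * s) - V t ≤ 3 * √2 * √s * (V (t * 2) - V t) := by
    intro t ht ht1 s hs
    obtain ⟨k, hk1, hk2⟩ := exists_nat_pow_near hs (by norm_num : (1:ℝ) < 2)
    have h3 : 0 ≤ V (t * 2) - V t := sub_nonneg.2 (hVmono _ _ ht1 (by linarith))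
    have h1 := hpow (k + 1) t ht ht1
    have h2 : V (t * s) ≤ V (t * 2 ^ (k + 1)) :=
      hVmono _ _ (by nlinarith) (by nlinarith)
    have h4 : √2 ^ k ≤ √s := by
      apply Real.le_sqrt_of_sq_le
      rw [← pow_mul, mul_comm, pow_mul, Real.sq_sqrt (by norm_num)]; exact hk1
    have h5 : 3 * (√2 ^ (k + 1) - 1) ≤ 3 * √2 * √s := by
      rw [pow_succ]; nlinarith
    nlinarith
  -- V eventually positive, D/V small
  obtain ⟨u0, hu0, hqu0⟩ := hpos
  have hVpos : ∀ᶠ t in atTop, 0 < V t := by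
    have : Tendsto (fun t : ℝ => 1 - 1 / t) atTop (𝓝 (1 - 0)) :=
by
      simp only [one_div]
      exact tendsto_const_nhds.sub tendsto_inv_atTop_zero
    rw [sub_zero] at this
    filter_upwards [this.eventually (lt_mem_nhds hu0.2), eventually_gt_atTop 1] with t ht ht1
    exact lt_of_lt_of_le hqu0 (hmono hu0 (hmem t ht1) ht.le)
  have hDV : ∀ δ : ℝ, 0 < δ → ∀ᶠ t in atTop, V (t * 2) - V t ≤ δ * V t := by
    intro δ hδ
    obtain ⟨N, hN⟩ := ((Real.tendsto_log_atTop.eventually_gt_atTop (Real.log 2 / δ)).and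
      (eventually_gt_atTop 1)).exists
    have hN0 : 0 < N := by linarith [hN.2]
    have h1 := hg N⁻¹ (by positivity)
    rw [Real.log_inv] at h1
    have h2 : Tendsto (fun t => -δ * ((V (t * N⁻¹) - V t) / a t) - (V (t * 2) - V t) / a t)
        atTop (𝓝 (-δ * -Real.log N - Real.log 2)) := (h1.const_mul _).sub hD2
    have h3 : 0 < -δ * -Real.log N - Real.log 2 := by
      have := (div_lt_iff₀ hδ).1 hN.1
      linarith
    have h4 : ∀ᶠ t in atTop, 0 < V (t * N⁻¹) :=
      (tendsto_id.atTop_mul_const (by positivity : 0 < N⁻¹)).eventually hVpos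
    filter_upwards [h2.eventually (lt_mem_nhds h3), h4] with t ht ht4
    have hat := ha t
    have : -δ * ((V (t * N⁻¹) - V t) / a t) - (V (t * 2) - V t) / a t =
        (-δ * (V (t * N⁻¹) - V t) - (V (t * 2) - V t)) / a t := by
      ring
    rw [this] at ht
    have := (div_pos_iff_of_pos_right hat).1 ht
    nlinarith
  have hlim : Tendsto (fun β : ℝ => (1 - β)⁻¹) (𝓝[<] 1) atTop := by
    apply Filter.Tendsto.inv_tendsto_nhdsGT_zero
    rw [tendsto_nhdsWithin_iff]
    constructor
    · have : Tendsto (fun β : ℝ => 1 - β) (𝓝 1) (𝓝 (1 - 1)) := tendsto_const_nhds.sub tendsto_id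
      rw [sub_self] at this
      exact this.mono_left nhdsWithin_le_nhds
    · filter_upwards [self_mem_nhdsWithin] with β hβ
      simpa using hβ
  filter_upwards [hlim.eventually hVpos, hlim.eventually (hDV (ε / (3 * √2 * 2)) (by positivity)),
    hlim.eventually (eventually_ge_atTop T), hlim.eventually (eventually_gt_atTop 1),
    self_mem_nhdsWithin] with β h1 h2 h3 h4 h5
  have hβ1 : β < 1 := h5
  have hb : 0 < 1 - β := by linarith
  have hVβ : V (1 - β)⁻¹ = q β := by simp [hV]
  have hβ0 : 0 < β := by
    have := (one_lt_inv₀ hb).1 h4; linarith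
  rw [hVβ] at h1 h2
  refine ⟨h1, ?_⟩
  set D := V ((1 - β)⁻¹ * 2) - q β with hDdef
  have hrI : IntervalIntegrable (fun u : ℝ => (1 - u) ^ (-(1/2) : ℝ)) volume β 1 := by
    have := (intervalIntegral.intervalIntegrable_rpow' (a := 1 - β) (b := 0)
      (by norm_num : (-1:ℝ) < -(1/2))).comp_sub_left 1
    simpa using this
  have hqI : IntervalIntegrable (fun u : ℝ => q u) volume β 1 := by
    rw [intervalIntegrable_iff_integrableOn_Ioo_of_le hβ1.le]
    exact hint.mono_set (Ioo_subset_Ioo_left hβ0.le)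
  have hbound : ∀ u ∈ Ioo β 1, q u - q β ≤ 3 * √2 * √(1 - β) * D * (1 - u) ^ (-(1/2) : ℝ) := by
    intro u hu
    have hu1 : 0 < 1 - u := by linarith [hu.2]
    have h := hpt _ h3 h4 ((1 - β) / (1 - u)) (by rw [le_div_iff₀ hu1]; linarith [hu.1])
    have e1 : (1 - β)⁻¹ * ((1 - β) / (1 - u)) = (1 - u)⁻¹ := by field_simp
    have e2 : V (1 - u)⁻¹ = q u := by simp [hV]
    rw [e1, e2, hVβ, Real.sqrt_div hb.le] at h
    rw [Real.rpow_neg hu1.le, ← Real.sqrt_eq_rpow]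
    calc _ ≤ _ := h
      _ = _ := by rw [hDdef]; ring
  have hI := intervalIntegral.integral_mono_on_of_le_Ioo hβ1.le
    (hqI.sub intervalIntegrable_const) (hrI.const_mul (3 * √2 * √(1 - β) * D)) hbound
  have hcomp : ∫ u in β..1, (1 - u) ^ (-(1/2) : ℝ) = 2 * √(1 - β) := by
    rw [intervalIntegral.integral_comp_sub_left (fun x : ℝ => x ^ (-(1/2) : ℝ)) 1,
      integral_rpow (Or.inl (by norm_num)), Real.sqrt_eq_rpow]
    norm_num
    ring
  rw [intervalIntegral.integral_const_mul, hcomp] at hI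
  refine hI.trans ?_
  have hs : √(1 - β) * √(1 - β) = 1 - β := Real.mul_self_sqrt hb.le
  calc 3 * √2 * √(1 - β) * D * (2 * √(1 - β)) = 3 * √2 * 2 * D * (√(1 - β) * √(1 - β)) := by ring
    _ = 3 * √2 * 2 * (1 - β) * D := by rw [hs]; ring
    _ ≤ 3 * √2 * 2 * (1 - β) * (ε / (3 * √2 * 2) * q β) :=
        mul_le_mul_of_nonneg_left h2 (by positivity)
    _ = _ := by field_simp

open ProbabilityTheory in
/-- Everything on the level of the law. -/
lemma gumbel_law (μ : Measure ℝ) [IsProbabilityMeasure μ] (hL : Integrable (fun x => x) μ)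
    (hmean : ∫ x, x ∂μ = 0) (a : ℝ → ℝ) (ha : ∀ t : ℝ, 0 < a t)
    (hg : ∀ x : ℝ, 0 < x →
      Tendsto (fun t : ℝ => (qf μ (1 - 1 / (t * x)) - qf μ (1 - 1 / t)) / a t)
        atTop (𝓝 (Real.log x)))
    (e : ℝ → ℝ)
    (he : ∀ α : ℝ, 1 / 2 ≤ α → α < 1 →
      (2 * α - 1) * ∫ x, max (x - e α) 0 ∂μ = (1 - α) * e α) :
    Tendsto (fun α => (1 - α) / (1 - cdf μ (e α))) (𝓝[<] (1 : ℝ)) (𝓝 0) ∧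
    (∀ᶠ α in 𝓝[<] (1:ℝ), 0 < e α) ∧
    (∀ᶠ α in 𝓝[<] (1:ℝ), cdf μ (e α) < 1) ∧
    (∀ y, cdf μ y < 1 → ∀ᶠ α in 𝓝[<] (1:ℝ), y < e α) ∧
    Tendsto (fun α => ((1 - α)⁻¹ * ∫ u in α..1, qf μ u) / qf μ α) (𝓝[<] (1 : ℝ)) (𝓝 1) := by
  have hmem : ∀ t : ℝ, 1 < t → 1 - 1 / t ∈ Ioo (0:ℝ) 1 := by
    intro t ht
    have h1 : 1 / t < 1 := by rw [div_lt_one (by linarith)]; exact ht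
    have h2 : 0 < 1 / t := by positivity
    constructor <;> linarith
  have hqI := qf_integrable μ hL
  have hstrict : ∀ u ∈ Ioo (0:ℝ) 1, ∃ v ∈ Ioo (0:ℝ) 1, qf μ u < qf μ v := by
    intro u hu
    have h1 := (hg 2 (by norm_num)).eventually (lt_mem_nhds (Real.log_pos (by norm_num)))
    obtain ⟨t, ht, ht1, ht2⟩ := (h1.and ((eventually_gt_atTop 1).and
      (eventually_gt_atTop (1 - u)⁻¹))).exists
    have h3 := (div_pos_iff_of_pos_right (ha t)).1 ht
    have hu1 : 0 < 1 - u := by linarith [hu.2]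
    refine ⟨1 - 1 / (t * 2), hmem _ (by linarith), ?_⟩
    have : qf μ u ≤ qf μ (1 - 1 / t) := by
      apply qf_mono μ hu (hmem t ht1)
      have := inv_strictAnti₀ (by positivity) ht2
      rw [inv_inv] at this
      rw [one_div]; linarith
    linarith
  have hcdf1 : ∀ u ∈ Ioo (0:ℝ) 1, cdf μ (qf μ u) < 1 := by
    intro u hu
    obtain ⟨v, hv, huv⟩ := hstrict u hu
    exact ((lt_qf_iff μ hv.1 hv.2 _).1 huv).trans hv.2
  have hmaxI : ∀ y : ℝ, Integrable (fun x => max (x - y) 0) μ := fun y =>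
    (hL.sub (integrable_const y)).pos_part
  have hpart : ∀ y, cdf μ y < 1 → 0 < ∫ x, max (x - y) 0 ∂μ := by
    intro y hy
    rw [integral_pos_iff_support_of_nonneg (f := fun x => max (x - y) 0)
      (fun x => le_max_right _ _) (hmaxI y)]
    have hs : Function.support (fun x => max (x - y) 0) = (Iic y)ᶜ := by
      ext x
      simp [Function.mem_support]
    rw [hs]
    rw [pos_iff_ne_zero]
    intro h0
    rw [prob_compl_eq_zero_iff measurableSet_Iic] at h0
    rw [cdf_eq_real, measureReal_def, h0] at hy
    simp at hy
  have hqpos : ∃ u ∈ Ioo (0:ℝ) 1, 0 < qf μ u := by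
    by_contra hcon
    push Not at hcon
    have h1 : ∫ u in Ioo (0:ℝ) 1, -qf μ u = 0 := by
      rw [integral_neg, ← qf_integral μ (fun x => x) measurable_id, hmean, neg_zero]
    have h2 := (setIntegral_eq_zero_iff_of_nonneg_ae (by
      filter_upwards [ae_restrict_mem measurableSet_Ioo] with u hu
      simpa using hcon u hu) hqI.neg).1 h1
    obtain ⟨v, hv, hv2⟩ := hstrict (1/2) (by norm_num)
    have h3 : qf μ (1/2) < 0 := lt_of_lt_of_le hv2 (hcon v hv)
    have h4 : ∀ᵐ u ∂(volume.restrict (Ioo (0:ℝ) (1/2))), False := by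
      have h5 := ae_restrict_of_ae_restrict_of_subset
        (Ioo_subset_Ioo_right (by norm_num : (1/2:ℝ) ≤ 1)) h2
      filter_upwards [h5, ae_restrict_mem measurableSet_Ioo] with u hu hu2
      have := qf_mono μ ⟨hu2.1, hu2.2.trans (by norm_num)⟩ (by norm_num : (1/2:ℝ) ∈ Ioo (0:ℝ) 1)
        hu2.2.le
      simp at hu
      linarith
    rw [eventually_false_iff_eq_bot, ae_eq_bot, Measure.restrict_eq_zero] at h4
    simp at h4
  have hcore := gumbel_core (qf μ) a ha (qf_mono μ) hqI hg hqpos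
  have hα0 : ∀ᶠ α in 𝓝[<] (1:ℝ), 1 / 2 < α ∧ α < 1 :=
    (((lt_mem_nhds (by norm_num : (1/2:ℝ) < 1)).filter_mono nhdsWithin_le_nhds)).and
      self_mem_nhdsWithin
  have hge : ∀ y, cdf μ y < 1 → ∀ᶠ α in 𝓝[<] (1:ℝ), y < e α := by
    intro y hy
    have hp := hpart y hy
    have hlim : Tendsto (fun α : ℝ => (2 * α - 1) * (∫ x, max (x - y) 0 ∂μ) - (1 - α) * y)
        (𝓝[<] 1) (𝓝 ((2 * 1 - 1) * (∫ x, max (x - y) 0 ∂μ) - (1 - 1) * y)) := by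
      apply tendsto_nhdsWithin_of_tendsto_nhds
      apply Continuous.tendsto
      fun_prop
    filter_upwards [hlim.eventually (lt_mem_nhds (a := 0) (by linarith)), hα0] with α h1 h2
    by_contra hcon
    push Not at hcon
    have h3 := he α h2.1.le h2.2
    have h4 : ∫ x, max (x - y) 0 ∂μ ≤ ∫ x, max (x - e α) 0 ∂μ :=
      integral_mono (hmaxI _) (hmaxI _) (fun x => max_le_max (by linarith) le_rfl)
    have h5 := mul_le_mul_of_nonneg_left h4 (by linarith : 0 ≤ 2 * α - 1)
    have h6 := mul_le_mul_of_nonneg_left hcon (by linarith : 0 ≤ 1 - α)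
    linarith
  have hepos : ∀ᶠ α in 𝓝[<] (1:ℝ), 0 < e α := by
    obtain ⟨u, hu, hqu⟩ := hqpos
    filter_upwards [hge _ (hcdf1 u hu)] with α h
    exact hqu.trans h
  have hFlt : ∀ᶠ α in 𝓝[<] (1:ℝ), cdf μ (e α) < 1 := by
    filter_upwards [hepos, hα0] with α h1 h2
    by_contra hcon
    have hF1 : cdf μ (e α) = 1 := le_antisymm (cdf_le_one μ _) (not_lt.1 hcon)
    have h0 : ∫ x, max (x - e α) 0 ∂μ = 0 := by
      apply integral_eq_zero_of_ae
      have : μ (Iic (e α)) = 1 := by rw [← ofReal_cdf, hF1]; simp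
      have := (mem_ae_iff_prob_eq_one measurableSet_Iic).2 this
      filter_upwards [this] with x hx
      simpa using hx
    have h3 := he α h2.1.le h2.2
    rw [h0, mul_zero] at h3
    have : 0 < (1 - α) * e α := mul_pos (by linarith [h2.2]) h1
    linarith
  have hβlim : Tendsto (fun α => cdf μ (e α)) (𝓝[<] 1) (𝓝[<] 1) := by
    rw [tendsto_nhdsWithin_iff]
    refine ⟨?_, hFlt⟩
    rw [tendsto_order]
    constructor
    · intro b hb
      have hu : max ((b + 1) / 2) (1/2) ∈ Ioo (0:ℝ) 1 :=
        ⟨lt_max_of_lt_right (by norm_num), max_lt (by linarith) (by norm_num)⟩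
      filter_upwards [hge _ (hcdf1 _ hu)] with α h
      have := (qf_le_iff μ hu.1 hu.2 _).1 h.le
      have h2 := le_max_left ((b + 1) / 2) (1/2)
      linarith
    · intro b hb
      exact Eventually.of_forall fun α => lt_of_le_of_lt (cdf_le_one μ _) hb
  refine ⟨?_, hepos, hFlt, hge, ?_⟩
  · rw [Metric.tendsto_nhds]
    intro ε hε
    filter_upwards [hepos, hFlt, hα0, hβlim.eventually (hcore (ε/2) (by positivity)),
      hβlim.eventually hα0] with α h1 h2 h3 h4 h5
    set β := cdf μ (e α) with hβ
    have hb : 0 < 1 - β := by linarith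
    have hba : 0 < 1 - α := by linarith [h3.2]
    rw [Real.dist_eq, sub_zero, abs_of_nonneg (by positivity), div_lt_iff₀ hb]
    have hqe : qf μ β ≤ e α := (qf_le_iff μ (by linarith) h5.2 _).2 le_rfl
    have hβ0 : 0 < β := by linarith [h5.1]
    have k1 : ∫ x, max (x - e α) 0 ∂μ ≤ ∫ x, max (x - qf μ β) 0 ∂μ :=
      integral_mono (hmaxI _) (hmaxI _) (fun x => max_le_max (by linarith) le_rfl)
    have k2 : ∫ x, max (x - qf μ β) 0 ∂μ = ∫ u in β..1, (qf μ u - qf μ β) := by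
      rw [qf_integral μ (fun x => max (x - qf μ β) 0) (by fun_prop),
        intervalIntegral.integral_of_le h5.2.le, integral_Ioc_eq_integral_Ioo]
      rw [setIntegral_eq_of_subset_of_forall_sdiff_eq_zero measurableSet_Ioo
        (Ioo_subset_Ioo_left hβ0.le)]
      · apply setIntegral_congr_fun measurableSet_Ioo
        intro u hu
        have := qf_mono μ ⟨hβ0, h5.2⟩ ⟨hβ0.trans hu.1, hu.2⟩ hu.1.le
        exact max_eq_left (by linarith)
      · intro u hu
        have : u ≤ β := by
          by_contra hc
          exact hu.2 ⟨not_le.1 hc, hu.1.2⟩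
        have := qf_mono μ hu.1 ⟨hβ0, h5.2⟩ this
        exact max_eq_right (by linarith)
    have k3 := he α h3.1.le h3.2
    have k4 : 0 ≤ ∫ x, max (x - e α) 0 ∂μ := integral_nonneg fun x => le_max_right _ _
    have k5 : (1 - α) * e α ≤ ε / 2 * ((1 - β) * qf μ β) := by
      rw [← k3]
      calc _ ≤ 1 * ∫ x, max (x - e α) 0 ∂μ :=
            mul_le_mul_of_nonneg_right (by linarith [h3.2]) k4
        _ ≤ _ := by rw [one_mul]; exact (k1.trans_eq k2).trans h4.2
    have k6 : ε / 2 * ((1 - β) * qf μ β) ≤ ε / 2 * ((1 - β) * e α) := by gcongr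
    have k7 : (1 - α) * e α ≤ (ε / 2 * (1 - β)) * e α := by linarith
    have k8 := le_of_mul_le_mul_right k7 h1
    have : 0 < ε * (1 - β) := by positivity
    linarith
  · rw [Metric.tendsto_nhds]
    intro ε hε
    filter_upwards [hα0, hcore (ε/2) (by positivity)] with α h1 h2
    have hb : 0 < 1 - α := by linarith [h1.2]
    have hα : α ∈ Ioo (0:ℝ) 1 := ⟨by linarith, h1.2⟩
    have hI : IntervalIntegrable (fun u : ℝ => qf μ u) volume α 1 := by
      rw [intervalIntegrable_iff_integrableOn_Ioo_of_le h1.2.le]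
      exact hqI.mono_set (Ioo_subset_Ioo_left hα.1.le)
    have h3 := h2.2
    have h4 : 0 ≤ ∫ u in α..1, (qf μ u - qf μ α) := by
      rw [intervalIntegral.integral_of_le h1.2.le, integral_Ioc_eq_integral_Ioo]
      apply setIntegral_nonneg measurableSet_Ioo
      intro u hu
      have := qf_mono μ hα ⟨hα.1.trans hu.1, hu.2⟩ hu.1.le
      linarith
    rw [intervalIntegral.integral_sub hI intervalIntegrable_const,
      intervalIntegral.integral_const, smul_eq_mul] at h3 h4
    set J := ∫ u in α..1, qf μ u
    have hq := h2.1
    have hpos2 : 0 < (1 - α) * qf μ α := by positivity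
    have : (1 - α)⁻¹ * J / qf μ α - 1 = (J - (1 - α) * qf μ α) / ((1 - α) * qf μ α) := by
      field_simp
    rw [Real.dist_eq, this, abs_of_nonneg (by positivity), div_lt_iff₀ hpos2]
    have : 0 < ε * ((1 - α) * qf μ α) := by positivity
    linarith

open ProbabilityTheory in
/-- Weibull-type tails: the expectile and the quantile are asymptotically equivalent. -/
lemma gumbel_weibull (μ : Measure ℝ) [IsProbabilityMeasure μ] (hL : Integrable (fun x => x) μ)
    (e : ℝ → ℝ)
    (he : ∀ α : ℝ, 1 / 2 ≤ α → α < 1 →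
      (2 * α - 1) * ∫ x, max (x - e α) 0 ∂μ = (1 - α) * e α)
    (h1 : Tendsto (fun α => (1 - α) / (1 - cdf μ (e α))) (𝓝[<] (1 : ℝ)) (𝓝 0))
    (h2 : ∀ᶠ α in 𝓝[<] (1:ℝ), cdf μ (e α) < 1)
    (h3 : ∀ y, cdf μ y < 1 → ∀ᶠ α in 𝓝[<] (1:ℝ), y < e α)
    (τ : ℝ) (hτ : 0 < τ) (g : ℝ → ℝ)
    (hrv : ∀ x : ℝ, 0 < x → Tendsto (fun t => g (t * x) / g t) atTop (𝓝 (x ^ (0:ℝ))))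
    (hF : ∀ᶠ x in atTop, cdf μ x = 1 - Real.exp (-(x ^ τ * g x))) :
    Tendsto e (𝓝[<] (1:ℝ)) atTop ∧
    Tendsto (fun α => e α / qf μ α) (𝓝[<] (1 : ℝ)) (𝓝 1) := by
  have hlt : ∀ y, cdf μ y < 1 := by
    intro y
    obtain ⟨x, hx, hxy⟩ := (hF.and (eventually_ge_atTop y)).exists
    have := monotone_cdf μ hxy
    have := Real.exp_pos (-(x ^ τ * g x))
    linarith
  have hetop : Tendsto e (𝓝[<] (1:ℝ)) atTop := by
    rw [tendsto_atTop]
    intro y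
    filter_upwards [h3 y (hlt y)] with α h using h.le
  refine ⟨hetop, ?_⟩
  set h : ℝ → ℝ := fun x => x ^ τ * g x with hh
  have hhtop : Tendsto h atTop atTop := by
    have : Tendsto (fun x => Real.exp (-(h x))) atTop (𝓝 0) := by
      have k : Tendsto (fun x => 1 - cdf μ x) atTop (𝓝 (1 - 1)) :=
        tendsto_const_nhds.sub (tendsto_cdf_atTop μ)
      rw [sub_self] at k
      refine k.congr' ?_
      filter_upwards [hF] with x hx
      rw [hx]; simp [hh]
    have := Real.tendsto_exp_comp_nhds_zero.1 this
    simpa [Function.comp_def] using tendsto_neg_atBot_atTop.comp this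
  have hdiff : ∀ y : ℝ, 1 < y → Tendsto (fun t => h (t * y) - h t) atTop atTop := by
    intro y hy
    have k1 : Tendsto (fun t => y ^ τ * (g (t * y) / g t) - 1) atTop (𝓝 (y ^ τ * y ^ (0:ℝ) - 1)) :=
      ((hrv y (by linarith)).const_mul _).sub_const 1
    have hpos : 0 < y ^ τ * y ^ (0:ℝ) - 1 := by
      rw [Real.rpow_zero, mul_one]
      linarith [Real.one_lt_rpow hy hτ]
    refine (hhtop.atTop_mul_pos hpos k1).congr' ?_
    filter_upwards [eventually_gt_atTop 0, hhtop.eventually_gt_atTop 0] with t ht ht2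
    have hgt : g t ≠ 0 := by
      intro h0
      simp [hh, h0] at ht2
    simp only [hh]
    rw [Real.mul_rpow ht.le (by linarith)]
    field_simp
  have hα0 : ∀ᶠ α in 𝓝[<] (1:ℝ), 3 / 4 < α ∧ α < 1 :=
    (((lt_mem_nhds (by norm_num : (3/4:ℝ) < 1)).filter_mono nhdsWithin_le_nhds)).and
      self_mem_nhdsWithin
  have hmaxI : ∀ y : ℝ, Integrable (fun x => max (x - y) 0) μ := fun y =>
    (hL.sub (integrable_const y)).pos_part
  have hup : ∀ᶠ α in 𝓝[<] (1:ℝ), e α < qf μ α := by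
    filter_upwards [h1.eventually (gt_mem_nhds one_pos), h2, hα0] with α k1 k2 k3
    rw [div_lt_one (by linarith)] at k1
    rw [lt_qf_iff μ (by linarith) k3.2]
    linarith
  have hlow : ∀ δ : ℝ, 0 < δ → ∀ᶠ α in 𝓝[<] (1:ℝ), qf μ α ≤ (1 + 2 * δ) * e α := by
    intro δ hδ
    have hy : 1 < (1 + 2 * δ) / (1 + δ) := by
      rw [one_lt_div (by linarith)]; linarith
    have ht1 : Tendsto (fun α => (1 + δ) * e α) (𝓝[<] (1:ℝ)) atTop :=
      hetop.const_mul_atTop (by linarith)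
    have ht2 : Tendsto (fun α => (1 + 2 * δ) * e α) (𝓝[<] (1:ℝ)) atTop :=
      hetop.const_mul_atTop (by linarith)
    have ht3 := (hdiff _ hy).comp ht1
    filter_upwards [hα0, ht1.eventually hF, ht2.eventually hF,
      ht3.eventually_ge_atTop (-Real.log (δ / 2)), hetop.eventually_gt_atTop 0]
      with α k1 k2 k3 k4 k5
    rw [qf_le_iff μ (by linarith) k1.2, k3]
    simp only [Function.comp] at k4
    rw [show (1 + δ) * e α * ((1 + 2 * δ) / (1 + δ)) = (1 + 2 * δ) * e α by field_simp] at k4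
    have m1 : Real.exp (-h ((1 + 2 * δ) * e α)) ≤ δ / 2 * Real.exp (-h ((1 + δ) * e α)) := by
      rw [← Real.exp_log (by positivity : 0 < δ / 2), ← Real.exp_add]
      apply Real.exp_le_exp.2
      linarith
    have m2 : δ * e α * Real.exp (-h ((1 + δ) * e α)) ≤ ∫ x, max (x - e α) 0 ∂μ := by
      have hr : μ.real (Ioi ((1 + δ) * e α)) = Real.exp (-h ((1 + δ) * e α)) := by
        rw [← compl_Iic, probReal_compl_eq_one_sub measurableSet_Iic, ← cdf_eq_real, k2]
        simp [hh]
      rw [← hr]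
      calc δ * e α * μ.real (Ioi ((1 + δ) * e α))
          = ∫ x in Ioi ((1 + δ) * e α), δ * e α ∂μ := by
            rw [setIntegral_const, smul_eq_mul, mul_comm]
        _ ≤ ∫ x in Ioi ((1 + δ) * e α), max (x - e α) 0 ∂μ := by
            apply setIntegral_mono_on (integrableOn_const (by simp)) (hmaxI _).integrableOn
              measurableSet_Ioi
            intro x hx
            have : (1 + δ) * e α < x := hx
            exact le_max_of_le_left (by linarith)
        _ ≤ _ := setIntegral_le_integral (hmaxI _)
            (Eventually.of_forall fun x => le_max_right _ _)
    have m3 := he α (by linarith) k1.2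
    have m4 : 1 / 2 * (δ * e α * Real.exp (-h ((1 + δ) * e α))) ≤ (1 - α) * e α := by
      rw [← m3]
      apply mul_le_mul (by linarith) m2 (by positivity) (by linarith)
    have m5 : (δ / 2 * Real.exp (-h ((1 + δ) * e α))) * e α ≤ (1 - α) * e α := by linarith
    have m6 := le_of_mul_le_mul_right m5 k5
    have m7 := m1.trans m6
    simp only [hh] at m7
    linarith
  rw [tendsto_order]
  constructor
  · intro b hb
    rcases le_or_gt b 0 with hb0 | hb0
    · filter_upwards [hup, hetop.eventually_gt_atTop 0] with α k1 k2
      have : 0 < e α / qf μ α := div_pos k2 (k2.trans k1)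
      linarith
    · have hb1 : 1 < b⁻¹ := (one_lt_inv₀ hb0).2 hb
      filter_upwards [hlow ((b⁻¹ - 1) / 4) (by linarith), hup, hetop.eventually_gt_atTop 0]
        with α k1 k2 k3
      rw [lt_div_iff₀ (k3.trans k2)]
      have k4 : (1 + 2 * ((b⁻¹ - 1) / 4)) * e α < b⁻¹ * e α :=
        mul_lt_mul_of_pos_right (by linarith) k3
      calc b * qf μ α < b * (b⁻¹ * e α) := mul_lt_mul_of_pos_left (k1.trans_lt k4) hb0
        _ = e α := by field_simp
  · intro b hb
    filter_upwards [hup, hetop.eventually_gt_atTop 0] with α k1 k2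
    have : e α / qf μ α < 1 := by rw [div_lt_one (k2.trans k1)]; exact k1
    linarith

/-- for centered `L` in the Gumbel MDA: (i) `(1-α)/(1-β*) → 0` as `α ↗ 1`
with `β* = P[L ≤ e_α(L)]`; (ii) if moreover `F(x) = 1 - exp(-x^τ g(x))` for large `x`
with `τ > 0` and slowly varying `g`, then `ln(e_α)/ln(ES_α) → 1`; and (iii) if in
addition `(g(cx)/g(x) - 1)·ln g(x) → 0` for some `c > 0`, then `e_α/ES_α → 1`. -/
theorem gumbel_asymptotics {Ω : Type*} [MeasurableSpace Ω] (P : Measure Ω)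
    [IsProbabilityMeasure P] (L : Ω → ℝ) (hL : Integrable L P)
    (hmean : (∫ ω, L ω ∂P) = 0)
    (a : ℝ → ℝ) (ha : ∀ t : ℝ, 0 < a t)
    (hgumbel : ∀ x : ℝ, 0 < x →
      Tendsto (fun t : ℝ =>
          (leftQuantile P L (1 - 1 / (t * x)) - leftQuantile P L (1 - 1 / t)) / a t)
        atTop (𝓝 (Real.log x)))
    (e : ℝ → ℝ) (he : ∀ α : ℝ, 1 / 2 ≤ α → α < 1 → IsExpectile P L α (e α)) :
    Tendsto (fun α => (1 - α) / (1 - (P {ω | L ω ≤ e α}).toReal))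
        (𝓝[<] (1 : ℝ)) (𝓝 0) ∧
      ∀ τ : ℝ, 0 < τ → ∀ g : ℝ → ℝ, RegularlyVarying g 0 →
        (∀ᶠ x in atTop, (P {ω | L ω ≤ x}).toReal = 1 - Real.exp (-(x ^ τ * g x))) →
        Tendsto (fun α => Real.log (e α) / Real.log (ES P L α)) (𝓝[<] (1 : ℝ)) (𝓝 1) ∧
          ((∃ c : ℝ, 0 < c ∧
              Tendsto (fun x => (g (c * x) / g x - 1) * Real.log (g x)) atTop (𝓝 0)) →
            Tendsto (fun α => e α / ES P L α) (𝓝[<] (1 : ℝ)) (𝓝 1)) := by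
  have hm := hL.aemeasurable
  set μ := P.map L with hμ
  have : IsProbabilityMeasure μ := Measure.isProbabilityMeasure_map hm
  have hcdf : ∀ x, (P {ω | L ω ≤ x}).toReal = ProbabilityTheory.cdf μ x := by
    intro x
    rw [ProbabilityTheory.cdf_eq_real, measureReal_def, hμ,
      Measure.map_apply_of_aemeasurable hm measurableSet_Iic]
    rfl
  have hq : leftQuantile P L = qf μ := by
    funext u
    simp only [leftQuantile, qf, hcdf]
  have hIμ : Integrable (fun x => x) μ :=
    (integrable_map_measure (g := fun x : ℝ => x) measurable_id.aestronglyMeasurable hm).2 hL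
  have hmeanμ : ∫ x, x ∂μ = 0 := by
    rw [hμ, integral_map (f := fun x : ℝ => x) hm measurable_id.aestronglyMeasurable]; exact hmean
  have heμ : ∀ α : ℝ, 1 / 2 ≤ α → α < 1 →
      (2 * α - 1) * ∫ x, max (x - e α) 0 ∂μ = (1 - α) * e α := by
    intro α h1 h2
    have h := he α h1 h2
    unfold IsExpectile at h
    have hmx : Measurable fun x : ℝ => max (x - e α) 0 := by fun_prop
    rw [hμ, integral_map hm hmx.aestronglyMeasurable]
    have h3 : ∫ ω, max (e α - L ω) 0 ∂P = (∫ ω, max (L ω - e α) 0 ∂P) + e α := by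
      have e1 : ∀ ω, max (e α - L ω) 0 = max (L ω - e α) 0 - (L ω - e α) := by
        intro ω
        rcases le_total (L ω) (e α) with h | h
        · rw [max_eq_left (by linarith), max_eq_right (by linarith)]; ring
        · rw [max_eq_right (by linarith), max_eq_left (by linarith)]; ring
      have i1 : Integrable (fun ω => L ω - e α) P := hL.sub (integrable_const _)
      simp_rw [e1]
      rw [integral_sub i1.pos_part i1, integral_sub hL (integrable_const _), hmean]
      simp
    rw [h3] at h
    linarith
  rw [hq] at hgumbel
  simp only [hcdf]
  obtain ⟨r1, r2, r3, r4, r5⟩ := gumbel_law μ hIμ hmeanμ a ha hgumbel e heμ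
  refine ⟨r1, ?_⟩
  intro τ hτ g hrv hF
  obtain ⟨s1, s2⟩ := gumbel_weibull μ hIμ e heμ r1 r3 r4 τ hτ g hrv hF
  have hES : ES P L = fun α => (1 - α)⁻¹ * ∫ u in α..1, qf μ u := by
    funext α
    simp only [ES, hq]
  have hratio : Tendsto (fun α => e α / ES P L α) (𝓝[<] (1 : ℝ)) (𝓝 1) := by
    have := s2.div r5 one_ne_zero
    rw [div_one] at this
    refine this.congr' ?_
    filter_upwards [s2.eventually (lt_mem_nhds one_pos)] with α h
    have hne : qf μ α ≠ 0 := by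
      intro h0
      rw [h0, div_zero] at h
      exact lt_irrefl _ h
    rw [hES]
    simp only [Pi.div_apply]
    rw [div_div_div_cancel_right₀ hne]
  refine ⟨?_, fun _ => hratio⟩
  have hlog : Tendsto (fun α => Real.log (e α)) (𝓝[<] (1 : ℝ)) atTop :=
    Real.tendsto_log_atTop.comp s1
  have hl0 : Tendsto (fun α => Real.log (e α / ES P L α)) (𝓝[<] (1 : ℝ)) (𝓝 0) := by
    have := hratio.log one_ne_zero
    rwa [Real.log_one] at this
  have hl1 : Tendsto (fun α => (1 - Real.log (e α / ES P L α) / Real.log (e α))⁻¹)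
      (𝓝[<] (1 : ℝ)) (𝓝 (1 - 0)⁻¹) :=
    (tendsto_const_nhds.sub (hl0.div_atTop hlog)).inv₀ (by norm_num)
  rw [sub_zero, inv_one] at hl1
  refine hl1.congr' ?_
  filter_upwards [hratio.eventually (lt_mem_nhds one_pos), r2, hlog.eventually_gt_atTop 0]
    with α k1 k2 k3
  have hESne : ES P L α ≠ 0 := by
    intro h0
    rw [h0, div_zero] at k1
    exact lt_irrefl _ k1
  rw [Real.log_div k2.ne' hESne, show 1 - (Real.log (e α) - Real.log (ES P L α)) / Real.log (e α)
    = Real.log (ES P L α) / Real.log (e α) by field_simp; ring, inv_div]
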